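/- arXiv:1105.2399 — 3 statements merged into one kernel-verified Lean document; each statement's English description precedes it below -/
import Mathlib

section
/- Let (R, m) be a commutative Noetherian local ring, M a finitely generated R-module of finite injective dimension, and L any finitely generated R-module. Then depth_R(L) + sup{ i : Ext_R^i(L, M) ≠ 0 } = depth(R). -/
open CategoryTheory IsLocalRing

noncomputable section

variable (R : Type) [CommRing R]

/-- The Ext group `Ext_R^i(M, N)` for `R`-modules, as an `R`-module. -/
abbrev ext (i : ℕ) (M N : Type) [AddCommGroup M] [Module R M]
    [AddCommGroup N] [Module R N] : ModuleCat R :=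
  ((Ext R (ModuleCat R) i).obj (Opposite.op (ModuleCat.of R M))).obj (ModuleCat.of R N)

/-- The depth of a module over a local ring: the supremum of lengths of
regular `M`-sequences with entries in the maximal ideal. -/
def depth [IsLocalRing R] (M : Type) [AddCommGroup M] [Module R M] : ℕ∞ :=
  sSup {n : ℕ∞ | ∃ rs : List R, (∀ x ∈ rs, x ∈ maximalIdeal R) ∧
    RingTheory.Sequence.IsRegular M rs ∧ (rs.length : ℕ∞) = n}

/-- The injective dimension of a module: the least `n` such that `M` admits an
injective resolution vanishing in degrees `> n`. -/
def injDim (M : Type) [AddCommGroup M] [Module R M] : ℕ∞ :=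
  sInf {n : ℕ∞ | ∃ I : InjectiveResolution (ModuleCat.of R M),
    ∀ i : ℕ, n < (i : ℕ∞) → Limits.IsZero (I.cocomplex.X i)}

/-- `sup{ i | Ext_R^i(M, N) ≠ 0 }` as an element of `ℕ∞`. -/
def extSup (M N : Type) [AddCommGroup M] [Module R M]
    [AddCommGroup N] [Module R N] : ℕ∞ :=
  sSup {n : ℕ∞ | ∃ i : ℕ, (i : ℕ∞) = n ∧ Nontrivial (ext R i M N)}

/-- A submodule is essential if it meets every nonzero submodule nontrivially;
`f : N →ₗ[R] E` realizes `E` as an injective hull of `N` if `E` is injective and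
`f` is an injective map with essential image. -/
def IsInjectiveHull (N E : Type) [AddCommGroup N] [Module R N]
    [AddCommGroup E] [Module R E] : Prop :=
  Module.Injective R E ∧ ∃ f : N →ₗ[R] E, Function.Injective f ∧
    ∀ S : Submodule R E, S ≠ ⊥ → LinearMap.range f ⊓ S ≠ ⊥

/-- `c` is the `i`-th Bass number `μ^i(𝔪, M)`: the dimension over the residue
field of `Ext_R^i(R/𝔪, M)`. -/
def IsBassNumberAtMax [IsLocalRing R] (i : ℕ) (M : Type) [AddCommGroup M] [Module R M]
    (c : Cardinal) : Prop :=
  ∃ ι : Type, Cardinal.mk ι = c ∧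
    Nonempty ((ext R i (ResidueField R) M) ≃ₗ[R] (ι →₀ ResidueField R))

section

open CategoryTheory.Abelian RingTheory.Sequence Pointwise

variable {R}

namespace CategoryTheory.ProjectiveResolution

/-- An extension class of degree zero vanishes only if its representing cocycle does. -/
lemma extMk_zero_eq_zero_iff {X Y : ModuleCat R} (P : ProjectiveResolution X)
    (f : P.complex.X 0 ⟶ Y) (hf : P.complex.d 1 0 ≫ f = 0) :
    P.extMk f 1 rfl hf = 0 ↔ f = 0 := by
  simp only [← P.extEquivCohomologyClass.apply_eq_iff_eq,
    extEquivCohomologyClass_extMk, extEquivCohomologyClass_zero,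
    CochainComplex.HomComplex.CohomologyClass.mk_eq_zero_iff]
  rw [CochainComplex.HomComplex.Cocycle.toSingleMk_mem_coboundaries_iff _ _ _ _ _ 1 (by simp)]
  have h0 : Limits.IsZero (P.cochainComplex.X 1) := P.cochainComplex.isZero_of_isStrictlyLE 0 1
  constructor
  · rintro ⟨g, hg⟩
    rw [h0.eq_of_src g 0, Limits.comp_zero] at hg
    rw [← cancel_epi (P.cochainComplexXIso _ 0 rfl).hom, ← hg, Limits.comp_zero]
  · rintro rfl
    exact ⟨0, by simp⟩

end CategoryTheory.ProjectiveResolution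

lemma subsingleton_ext_iff (i : ℕ) (M N : Type) [AddCommGroup M] [Module R M]
    [AddCommGroup N] [Module R N] :
    Subsingleton (ext R i M N) ↔
      Subsingleton (Abelian.Ext (ModuleCat.of R M) (ModuleCat.of R N) i) := by
  let P := projectiveResolution (ModuleCat.of R M)
  rw [← ModuleCat.isZero_iff_subsingleton, (P.isoExt (R := R) i (ModuleCat.of R N)).isZero_iff,
    ← HomologicalComplex.exactAt_iff_isZero_homology]
  have hsub : Subsingleton (Abelian.Ext (ModuleCat.of R M) (ModuleCat.of R N) i) ↔
      ∀ (f : P.complex.X i ⟶ ModuleCat.of R N) (hf : P.complex.d (i + 1) i ≫ f = 0),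
        P.extMk f (i + 1) rfl hf = 0 := by
    refine ⟨fun _ f hf ↦ Subsingleton.elim _ _, fun h ↦ subsingleton_of_forall_eq 0 fun x ↦ ?_⟩
    obtain ⟨f, hf, rfl⟩ := P.extMk_surjective x (i + 1) rfl
    exact h f hf
  rw [hsub]
  cases i with
  | zero =>
    rw [HomologicalComplex.exactAt_iff' _ 0 0 1 (by simp) (by simp),
      ShortComplex.moduleCat_exact_iff]
    simp only [P.extMk_zero_eq_zero_iff]
    constructor
    · intro h f hf
      obtain ⟨g, hg⟩ := h f hf
      rw [← hg]
      have : (P.complex.linearYonedaObj R (ModuleCat.of R N)).d 0 0 = 0 :=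
        HomologicalComplex.shape _ _ _ (by simp)
      exact congr($(this) g)
    · intro h f hf
      exact ⟨0, (map_zero _).trans (h f hf).symm⟩
  | succ i =>
    rw [HomologicalComplex.exactAt_iff' _ i (i + 1) (i + 1 + 1) (by simp) (by simp),
      ShortComplex.moduleCat_exact_iff]
    simp only [P.extMk_eq_zero_iff _ _ _ _ i rfl]
    rfl

lemma exists_subsingleton_ext_of_injDim_lt_top {M : Type} [AddCommGroup M] [Module R M]
    (hM : injDim R M < ⊤) :
    ∃ n : ℕ, ∀ i, n < i → ∀ L : ModuleCat.{0} R,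
      Subsingleton (Abelian.Ext L (ModuleCat.of R M) i) := by
  obtain ⟨n, ⟨I, hI⟩, hn⟩ := sInf_lt_iff.mp hM
  lift n to ℕ using hn.ne
  refine ⟨n, fun i hi L ↦ subsingleton_of_forall_eq 0 fun x ↦ ?_⟩
  obtain ⟨f, hf, rfl⟩ := I.extMk_surjective x (i + 1) rfl
  obtain rfl := (hI i (by exact_mod_cast hi)).eq_of_tgt f 0
  simp

lemma subsingleton_ext_of_exact {N₁ N₂ N₃ : Type} [AddCommGroup N₁] [Module R N₁]
    [AddCommGroup N₂] [Module R N₂] [AddCommGroup N₃] [Module R N₃]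
    {f : N₁ →ₗ[R] N₂} {g : N₂ →ₗ[R] N₃} (hf : Function.Injective f) (hg : Function.Surjective g)
    (hfg : Function.Exact f g) (M : ModuleCat.{0} R) (i : ℕ)
    (h₁ : Subsingleton (Abelian.Ext (ModuleCat.of R N₁) M i))
    (h₃ : Subsingleton (Abelian.Ext (ModuleCat.of R N₃) M i)) :
    Subsingleton (Abelian.Ext (ModuleCat.of R N₂) M i) := by
  let S : ShortComplex (ModuleCat.{0} R) :=
    ModuleCat.shortComplexOfCompEqZero f g hfg.linearMap_comp_eq_zero
  have hS : S.ShortExact := ModuleCat.shortComplex_shortExact S hfg hf hg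
  refine subsingleton_of_forall_eq 0 fun y ↦ ?_
  obtain ⟨z, rfl⟩ := Ext.contravariant_sequence_exact₂ hS M y (h₁.elim _ _)
  rw [h₃.elim z 0, Ext.comp_zero]

lemma subsingleton_ext_of_injective {N₁ N₂ : Type} [AddCommGroup N₁] [Module R N₁]
    [AddCommGroup N₂] [Module R N₂] {f : N₁ →ₗ[R] N₂} (hf : Function.Injective f)
    (M : ModuleCat.{0} R) (i : ℕ)
    (h₂ : Subsingleton (Abelian.Ext (ModuleCat.of R N₂) M i))
    (h₃ : Subsingleton (Abelian.Ext (ModuleCat.of R (N₂ ⧸ LinearMap.range f)) M (i + 1))) :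
    Subsingleton (Abelian.Ext (ModuleCat.of R N₁) M i) := by
  let S : ShortComplex (ModuleCat.{0} R) :=
    ModuleCat.shortComplexOfCompEqZero f _ f.exact_map_mkQ_range.linearMap_comp_eq_zero
  have hS : S.ShortExact := ModuleCat.shortComplex_shortExact S f.exact_map_mkQ_range hf
    (Submodule.mkQ_surjective _)
  refine subsingleton_of_forall_eq 0 fun y ↦ ?_
  obtain ⟨z, rfl⟩ := Ext.contravariant_sequence_exact₁ hS M (n₀ := i) y (add_comm 1 i)
    (h₃.elim _ _)
  rw [h₂.elim z 0, Ext.comp_zero]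

lemma subsingleton_ext_congr {N N' : Type} [AddCommGroup N] [Module R N]
    [AddCommGroup N'] [Module R N'] (e : N ≃ₗ[R] N') (M : ModuleCat.{0} R) (i : ℕ)
    (h : Subsingleton (Abelian.Ext (ModuleCat.of R N') M i)) :
    Subsingleton (Abelian.Ext (ModuleCat.of R N) M i) := by
  refine subsingleton_of_forall_eq 0 fun y ↦ ?_
  have : y = (Ext.mk₀ e.toModuleIso.hom).comp ((Ext.mk₀ e.toModuleIso.inv).comp y (zero_add i))
      (zero_add i) := by
    rw [Ext.mk₀_comp_mk₀_assoc, Iso.hom_inv_id, Ext.mk₀_id_comp]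
  rw [this, h.elim ((Ext.mk₀ e.toModuleIso.inv).comp y (zero_add i)) 0, Ext.comp_zero]

lemma isSMulRegular_quotient_of_notMem {p : Ideal R} [p.IsPrime] {x : R} (hx : x ∉ p) :
    IsSMulRegular (R ⧸ p) x := by
  refine isSMulRegular_iff_right_eq_zero_of_smul.mpr fun a ha ↦ ?_
  rw [Algebra.smul_def, mul_eq_zero] at ha
  exact ha.resolve_left fun h ↦ hx (Ideal.Quotient.eq_zero_iff_mem.mp h)

lemma not_subsingleton_ext_self_zero (M : Type) [AddCommGroup M] [Module R M] [Nontrivial M] :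
    ¬ Subsingleton (Abelian.Ext (ModuleCat.of R R) (ModuleCat.of R M) 0) := by
  intro h
  have : Subsingleton (ModuleCat.of R R ⟶ ModuleCat.of R M) :=
    Ext.addEquiv₀.symm.toEquiv.subsingleton
  have : Subsingleton (R →ₗ[R] M) :=
    (ModuleCat.homAddEquiv (M := ModuleCat.of R R) (N := ModuleCat.of R M)).symm.subsingleton
  exact not_subsingleton M (LinearMap.ringLmapEquivSelf R R M).symm.subsingleton

lemma extSup_self_eq_zero (M : Type) [AddCommGroup M] [Module R M] : extSup R R M = 0 := by
  refine nonpos_iff_eq_zero.mp (sSup_le ?_)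
  rintro _ ⟨i, rfl, hi⟩
  rw [← not_subsingleton_iff_nontrivial, subsingleton_ext_iff] at hi
  cases i with
  | zero => simp
  | succ i => exact (hi (Ext.subsingleton_of_projective _ _ i)).elim

section LocalRing

variable [IsLocalRing R] [IsNoetherianRing R]

lemma subsingleton_ext_of_subsingleton_ext_quotSMulTop {L M : ModuleCat.{0} R}
    [Module.Finite R L] [Module.Finite R M] {x : R} (hx : x ∈ maximalIdeal R)
    (reg : IsSMulRegular L x) {i : ℕ}
    (h : Subsingleton (Abelian.Ext (ModuleCat.of R (QuotSMulTop x L)) M (i + 1))) :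
    Subsingleton (Abelian.Ext L M i) := by
  by_contra! ntr
  refine Submodule.top_ne_pointwise_smul_of_mem_jacobson_annihilator (R := R)
    (M := Abelian.Ext L M i) (maximalIdeal_le_jacobson _ hx) ?_
  rw [eq_comm, eq_top_iff]
  intro y _
  have smul_eq (z : Abelian.Ext L M i) :
      (Ext.mk₀ (x • 𝟙 L)).comp z (zero_add i) = x • z := by simp [Ext.mk₀_smul]
  obtain ⟨z, rfl⟩ := Ext.contravariant_sequence_exact₁ reg.smulShortComplex_shortExact M
    (n₀ := i) y (add_comm 1 i) (h.elim _ _)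
  exact (smul_eq z).symm ▸ Submodule.smul_mem_pointwise_smul _ _ ⊤ trivial

/-- For a module of finite injective dimension, the vanishing of `Ext` in high degrees can be
tested on the residue field. -/
lemma subsingleton_ext_of_subsingleton_ext_residueField {M : ModuleCat.{0} R}
    [Module.Finite R M] {n : ℕ}
    (hn : ∀ i, n < i → ∀ L : ModuleCat.{0} R, Subsingleton (Abelian.Ext L M i)) {s : ℕ}
    (hs : ∀ i, s ≤ i → Subsingleton (Abelian.Ext (ModuleCat.of R (ResidueField R)) M i))
    (L : Type) [AddCommGroup L] [Module R L] [Module.Finite R L] {i : ℕ} (hi : s ≤ i) :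
    Subsingleton (Abelian.Ext (ModuleCat.of R L) M i) := by
  suffices ∀ k i, n < i + k → s ≤ i → ∀ (L : Type) [AddCommGroup L] [Module R L]
      [Module.Finite R L], Subsingleton (Abelian.Ext (ModuleCat.of R L) M i) from
    this (n + 1) i (by lia) hi L
  intro k
  induction k with
  | zero => exact fun i hin _ L _ _ _ ↦ hn i hin _
  | succ k ih =>
    intro i hin hi L _ _ _
    induction ‹Module.Finite R L› using
      IsNoetherianRing.induction_on_isQuotientEquivQuotientPrime R with
    | subsingleton N =>
      refine subsingleton_of_forall_eq 0 fun y ↦ ?_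
      rw [← Ext.mk₀_id_comp y, (ModuleCat.isZero_of_subsingleton (ModuleCat.of R N)).eq_of_src
        (𝟙 (ModuleCat.of R N)) 0, Ext.mk₀_zero, Ext.zero_comp]
    | quotient N p e =>
      by_cases hp : maximalIdeal R ≤ p.1
      · have hp' : p.1 = maximalIdeal R := (le_maximalIdeal p.2.ne_top).antisymm hp
        exact subsingleton_ext_congr (e.trans (Submodule.quotEquivOfEq _ _ hp')) M i (hs i hi)
      · obtain ⟨x, hx, hxp⟩ := SetLike.not_le_iff_exists.mp hp
        have reg : IsSMulRegular N x :=
          (e.isSMulRegular_congr x).mpr (isSMulRegular_quotient_of_notMem hxp)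
        exact subsingleton_ext_of_subsingleton_ext_quotSMulTop (L := ModuleCat.of R N) hx reg
          (ih (i + 1) (by lia) (by lia) _)
    | exact N₁ N₂ N₃ f g hf hg hfg h₁ h₃ =>
      exact subsingleton_ext_of_exact hf hg hfg M i h₁ h₃

/-- A nonzero finitely generated module of finite injective dimension has a largest degree in which
the `Ext` group of the residue field does not vanish, and it bounds the degrees of all nonzero
`Ext` groups of finitely generated modules. -/
lemma exists_ext_residueField_nontrivial (M : Type) [AddCommGroup M] [Module R M]
    [Module.Finite R M] [Nontrivial M] (hM : injDim R M < ⊤) :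
    ∃ r : ℕ, Nontrivial (Abelian.Ext (ModuleCat.of R (ResidueField R)) (ModuleCat.of R M) r) ∧
      ∀ (L : Type) [AddCommGroup L] [Module R L] [Module.Finite R L] (i : ℕ), r < i →
        Subsingleton (Abelian.Ext (ModuleCat.of R L) (ModuleCat.of R M) i) := by
  classical
  obtain ⟨n, hn⟩ := exists_subsingleton_ext_of_injDim_lt_top hM
  have key {s : ℕ} (hs : ∀ i, s ≤ i → Subsingleton
      (Abelian.Ext (ModuleCat.of R (ResidueField R)) (ModuleCat.of R M) i)) (L : Type)
      [AddCommGroup L] [Module R L] [Module.Finite R L] {i : ℕ} (hi : s ≤ i) :=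
    subsingleton_ext_of_subsingleton_ext_residueField hn hs L hi
  have hex : ∃ s, ∀ i, s ≤ i → Subsingleton
      (Abelian.Ext (ModuleCat.of R (ResidueField R)) (ModuleCat.of R M) i) :=
    ⟨n + 1, fun i hi ↦ hn i hi _⟩
  cases hs : Nat.find hex with
  | zero => exact (not_subsingleton_ext_self_zero M (key (hs ▸ Nat.find_spec hex) R le_rfl)).elim
  | succ r =>
    have hr := hs ▸ Nat.find_spec hex
    refine ⟨r, ?_, fun L _ _ _ i hi ↦ key hr L hi⟩
    by_contra! h
    refine Nat.find_min hex (m := r) (by lia) fun i hi ↦ ?_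
    obtain rfl | hi := hi.eq_or_lt
    exacts [h, hr i hi]

lemma exists_injective_residueField {L : Type} [AddCommGroup L] [Module R L] [Module.Finite R L]
    (h : ∀ x ∈ maximalIdeal R, ¬ IsSMulRegular L x) :
    ∃ f : ResidueField R →ₗ[R] L, Function.Injective f := by
  have : IsSimpleModule R (ResidueField R) :=
    isSimpleModule_iff_quot_maximal.mpr ⟨maximalIdeal R, inferInstance, ⟨LinearEquiv.refl R _⟩⟩
  have hsub : ¬ Subsingleton (ResidueField R →ₗ[R] L) := by
    rw [IsSMulRegular.subsingleton_linearMap_iff]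
    rintro ⟨x, hx, reg⟩
    refine h x ?_ reg
    rwa [← Ideal.annihilator_quotient (I := maximalIdeal R)]
  have := not_subsingleton_iff_nontrivial.mp hsub
  obtain ⟨f, hf⟩ := exists_ne (0 : ResidueField R →ₗ[R] L)
  exact ⟨f, f.injective_or_eq_zero.resolve_right hf⟩

lemma subsingleton_ext_of_isRegular {M : ModuleCat.{0} R} [Module.Finite R M] {r : ℕ}
    (hr : ∀ (L : Type) [AddCommGroup L] [Module R L] [Module.Finite R L] (i : ℕ), r < i →
        Subsingleton (Abelian.Ext (ModuleCat.of R L) M i))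
    {rs : List R} (mem : ∀ x ∈ rs, x ∈ maximalIdeal R)
    (L : Type) [AddCommGroup L] [Module R L] [Module.Finite R L] (reg : IsRegular L rs) {i : ℕ}
    (hi : r < i + rs.length) : Subsingleton (Abelian.Ext (ModuleCat.of R L) M i) := by
  induction rs generalizing L i with
  | nil => exact hr L i hi
  | cons x rs ih =>
    simp only [List.mem_cons, forall_eq_or_imp] at mem
    rw [isRegular_cons_iff] at reg
    rw [List.length_cons] at hi
    exact subsingleton_ext_of_subsingleton_ext_quotSMulTop (L := ModuleCat.of R L) mem.1 reg.1
      (ih mem.2 (QuotSMulTop x L) reg.2 (by lia))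

lemma exists_nontrivial_ext_of_isRegular {M : ModuleCat.{0} R} [Module.Finite R M] {r : ℕ}
    (hk : Nontrivial (Abelian.Ext (ModuleCat.of R (ResidueField R)) M r))
    (hr : ∀ (L : Type) [AddCommGroup L] [Module R L] [Module.Finite R L] (i : ℕ), r < i →
        Subsingleton (Abelian.Ext (ModuleCat.of R L) M i))
    {rs : List R} (mem : ∀ x ∈ rs, x ∈ maximalIdeal R)
    (L : Type) [AddCommGroup L] [Module R L] [Module.Finite R L] (reg : IsRegular L rs)
    (hmax : ∀ rs' : List R, (∀ x ∈ rs', x ∈ maximalIdeal R) → IsRegular L rs' →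
      rs'.length ≤ rs.length) :
    ∃ e, e + rs.length = r ∧ Nontrivial (Abelian.Ext (ModuleCat.of R L) M e) := by
  induction rs generalizing L with
  | nil =>
    have hL : Nontrivial L := reg.nontrivial
    obtain ⟨f, hf⟩ := exists_injective_residueField (L := L) fun x hx hxL ↦ by
      have := hmax [x] (by simpa using hx)
        (.of_isWeaklyRegular_of_mem_maximalIdeal L (by simpa using hx) (by simpa using hxL))
      simp at this
    refine ⟨r, rfl, ?_⟩
    by_contra! h
    exact not_subsingleton _ (subsingleton_ext_of_injective hf M r h (hr _ _ r.lt_succ_self))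
  | cons x rs ih =>
    have hlt {i : ℕ} := subsingleton_ext_of_isRegular hr mem L reg (i := i)
    simp only [List.mem_cons, forall_eq_or_imp] at mem
    rw [isRegular_cons_iff] at reg
    obtain ⟨e, he, hne⟩ := ih mem.2 (QuotSMulTop x L) reg.2 fun rs' mem' reg' ↦ by
      simpa using hmax (x :: rs') (by simpa using ⟨mem.1, mem'⟩) (.cons reg.1 reg')
    have hS := (show IsSMulRegular (ModuleCat.of R L) x from reg.1).smulShortComplex_shortExact
    have hL : Subsingleton (Abelian.Ext (ModuleCat.of R L) M e) :=
      hlt (by rw [List.length_cons]; lia)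
    obtain ⟨y, hy⟩ := exists_ne (0 : Abelian.Ext (ModuleCat.of R (QuotSMulTop x L)) M e)
    have hgy : (Ext.mk₀ ((ModuleCat.of R L).smulShortComplex x).g).comp y (zero_add e) = 0 :=
      hL.elim _ _
    cases e with
    | zero =>
      refine (hy (Ext.precomp_mk₀_injective_of_epi M
        ((ModuleCat.of R L).smulShortComplex x).g ?_)).elim
      exact hL.elim _ _
    | succ e =>
      refine ⟨e, by rw [List.length_cons]; lia, ?_⟩
      by_contra! h
      obtain ⟨z, rfl⟩ := Ext.contravariant_sequence_exact₃ hS M y hgy (n₀ := e) (add_comm 1 e)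
      obtain rfl : z = 0 := h.elim _ _
      exact hy (Ext.comp_zero _ _ _ _ _)

lemma exists_isRegular_depth_eq (L : Type) [AddCommGroup L] [Module R L] [Module.Finite R L]
    [Nontrivial L] :
    ∃ rs : List R, (∀ x ∈ rs, x ∈ maximalIdeal R) ∧ IsRegular L rs ∧
      (∀ rs' : List R, (∀ x ∈ rs', x ∈ maximalIdeal R) → IsRegular L rs' →
        rs'.length ≤ rs.length) ∧ depth R L = rs.length := by
  let P (n : ℕ) : Prop :=
    ∃ rs : List R, (∀ x ∈ rs, x ∈ maximalIdeal R) ∧ IsRegular L rs ∧ rs.length = n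
  have hb : BddAbove {n | P n} := by
    obtain ⟨d, hd⟩ : ∃ d : ℕ, ringKrullDim R = d :=
      ⟨_, Order.krullDim_eq_length_of_finiteDimensionalOrder⟩
    refine ⟨d, ?_⟩
    rintro _ ⟨rs, -, reg, rfl⟩
    have : Nontrivial (L ⧸ Ideal.ofList rs • (⊤ : Submodule R L)) :=
      reg.quot_ofList_smul_nontrivial ⊤
    have hdim := Module.supportDim_add_length_eq_supportDim_of_isRegular rs reg
    have hle := Module.supportDim_le_ringKrullDim R L
    rw [← hdim, hd] at hle
    have h0 : 0 ≤ Module.supportDim R (L ⧸ Ideal.ofList rs • (⊤ : Submodule R L)) :=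
      Order.krullDim_nonneg_iff.mpr Module.nonempty_support_of_nontrivial.to_subtype
    exact_mod_cast (le_add_of_nonneg_left h0).trans hle
  obtain ⟨rs, mem, reg, hrs⟩ : P (sSup {n | P n}) :=
    Nat.sSup_mem ⟨0, show P 0 from ⟨[], by simp, .nil R L, rfl⟩⟩ hb
  have hmax (rs' : List R) (mem' : ∀ x ∈ rs', x ∈ maximalIdeal R) (reg' : IsRegular L rs') :
      rs'.length ≤ rs.length := hrs ▸ le_csSup hb ⟨rs', mem', reg', rfl⟩
  refine ⟨rs, mem, reg, hmax, le_antisymm (sSup_le ?_) (le_sSup ⟨rs, mem, reg, rfl⟩)⟩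
  rintro _ ⟨rs', mem', reg', rfl⟩
  exact_mod_cast hmax rs' mem' reg'

lemma exists_depth_add_extSup_eq (M : Type) [AddCommGroup M] [Module R M]
    [Module.Finite R M] [Nontrivial M] (hM : injDim R M < ⊤) :
    ∃ r : ℕ, ∀ (L : Type) [AddCommGroup L] [Module R L] [Module.Finite R L] [Nontrivial L],
      depth R L + extSup R L M = r := by
  obtain ⟨r, hk, hr⟩ := exists_ext_residueField_nontrivial M hM
  refine ⟨r, fun L _ _ _ _ ↦ ?_⟩
  obtain ⟨rs, mem, reg, hmax, hd⟩ := exists_isRegular_depth_eq (R := R) L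
  obtain ⟨e, he, hne⟩ := exists_nontrivial_ext_of_isRegular hk hr mem L reg hmax
  have hext : extSup R L M = e := by
    refine le_antisymm (sSup_le ?_) (le_sSup ⟨e, rfl, ?_⟩)
    · rintro _ ⟨i, rfl, hi⟩
      rw [← not_subsingleton_iff_nontrivial, subsingleton_ext_iff] at hi
      by_contra! h
      have h : e < i := by exact_mod_cast h
      exact hi (subsingleton_ext_of_isRegular hr mem L reg (by lia))
    · rw [← not_subsingleton_iff_nontrivial, subsingleton_ext_iff]
      exact not_subsingleton _
  rw [hd, hext, ← he]
  push_cast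
  ring

end LocalRing

end

variable [IsNoetherianRing R] [IsLocalRing R]


/-- **Ischebeck's formula.** If `M` is a nonzero finitely generated module of finite
injective dimension over a Noetherian local ring `R`, then for every nonzero finitely
generated `R`-module `L`, `depth L + sup{i | Ext^i(L, M) ≠ 0} = depth R`. -/
theorem ischebeck_formula
    (M : Type) [AddCommGroup M] [Module R M] [Module.Finite R M] [Nontrivial M]
    (hM : injDim R M < ⊤)
    (L : Type) [AddCommGroup L] [Module R L] [Module.Finite R L] [Nontrivial L] :
    depth R L + extSup R L M = depth R R := by
  obtain ⟨r, hr⟩ := exists_depth_add_extSup_eq M hM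
  rw [hr L, ← hr R, extSup_self_eq_zero, add_zero]


end
end

section
/- Let (R, m) be a commutative Noetherian local ring admitting a nonzero finitely generated R-module M of finite injective dimension. Then id_R(M) = depth(R) and R is Cohen-Macaulay... specifically: id_R(M) = depth(R) (Bass equality). -/
open CategoryTheory IsLocalRing

noncomputable section

variable (R : Type) [CommRing R]

variable [IsNoetherianRing R] [IsLocalRing R]

universe v u

namespace CategoryTheory.InjectiveResolution

variable {C : Type u} [Category.{v} C] [Abelian C]

lemma hasInjectiveDimensionLE_of_isZero {X : C} (I : InjectiveResolution X) {n : ℕ}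
    (h : ∀ i, n < i → Limits.IsZero (I.cocomplex.X i)) : HasInjectiveDimensionLE X n := by
  let := HasExt.standard C
  refine HasInjectiveDimensionLT.mk fun i hi Y e ↦ ?_
  obtain ⟨f, hf, rfl⟩ := I.extMk_surjective e (i + 1) rfl
  have : f = 0 := (h i hi).eq_of_tgt _ _
  subst this
  simp

/-- An exact sequence `0 ⟶ X ⟶ K⁰ ⟶ K¹ ⟶ ⋯` with all `Kⁱ` injective is an injective resolution. -/
def ofExact {X : C} (K : CochainComplex C ℕ) (f : X ⟶ K.X 0) (mono : Mono f)
    (w : f ≫ K.d 0 1 = 0) (exact_zero : (ShortComplex.mk f (K.d 0 1) w).Exact)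
    (exactAt : ∀ n, K.ExactAt (n + 1)) (inj : ∀ n, Injective (K.X n)) :
    InjectiveResolution X where
  cocomplex := K
  injective := inj
  ι := (CochainComplex.fromSingle₀Equiv K X).symm ⟨f, w⟩
  quasiIso := ⟨fun n ↦ by
    cases n with
    | zero =>
      rw [CochainComplex.quasiIsoAt₀_iff]
      refine (ShortComplex.quasiIso_iff_of_zeros _ rfl rfl (K.shape 0 0 (by simp))).2 ?_
      have h : ((CochainComplex.fromSingle₀Equiv K X).symm ⟨f, w⟩).f 0 = f :=
        CochainComplex.fromSingle₀Equiv_symm_apply_f_zero f w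
      refine (ShortComplex.exact_and_mono_f_iff_of_iso
        (S₂ := ShortComplex.mk f (K.d 0 1) w) ?_).2 ⟨exact_zero, mono⟩
      exact ShortComplex.isoMk (Iso.refl _) (Iso.refl _) (Iso.refl _)
        ((Category.id_comp _).trans (h.symm.trans (Category.comp_id _).symm))
        ((Category.id_comp _).trans (Category.comp_id _).symm)
    | succ n =>
      rw [quasiIsoAt_iff_exactAt]
      · exact exactAt n
      · exact CochainComplex.exactAt_succ_single_obj _ _⟩

/-- Splice an injective resolution of `S.X₃` with a short exact sequence whose middle term is
injective to obtain an injective resolution of `S.X₁`. -/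
def ofShortExact {S : ShortComplex C} (hS : S.ShortExact) [Injective S.X₂]
    (J : InjectiveResolution S.X₃) : InjectiveResolution S.X₁ :=
  let j : S.X₃ ⟶ J.cocomplex.X 0 := J.ι.f 0
  have hj : j ≫ J.cocomplex.d 0 1 = 0 := J.ι_f_zero_comp_complex_d
  have : Mono j := inferInstanceAs (Mono (J.ι.f 0))
  have hgj : (S.g ≫ j) ≫ J.cocomplex.d 0 1 = 0 := by rw [Category.assoc, hj, Limits.comp_zero]
  have hfg : S.f ≫ S.g ≫ j = 0 := by rw [S.zero_assoc, Limits.zero_comp]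
  ofExact (J.cocomplex.augment (S.g ≫ j) hgj) S.f hS.mono_f hfg
    (by
      let φ : S ⟶ ShortComplex.mk S.f (S.g ≫ j) hfg :=
        { τ₁ := 𝟙 _, τ₂ := 𝟙 _, τ₃ := j }
      have : Mono φ.τ₃ := inferInstanceAs (Mono j)
      have : Epi φ.τ₁ := inferInstanceAs (Epi (𝟙 _))
      have : IsIso φ.τ₂ := inferInstanceAs (IsIso (𝟙 _))
      exact (ShortComplex.exact_iff_of_epi_of_isIso_of_mono φ).1 hS.exact)
    (fun n ↦ by
      rw [HomologicalComplex.exactAt_iff' _ n (n + 1) (n + 1 + 1) (by simp) (by simp)]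
      cases n with
      | zero =>
        let T := ShortComplex.mk (S.g ≫ j) (J.cocomplex.d 0 1) hgj
        let T' := ShortComplex.mk j (J.cocomplex.d 0 1) hj
        let φ : T ⟶ T' := { τ₁ := S.g, τ₂ := 𝟙 _, τ₃ := 𝟙 _ }
        have : Mono φ.τ₃ := inferInstanceAs (Mono (𝟙 _))
        have : Epi φ.τ₁ := hS.epi_g
        have : IsIso φ.τ₂ := inferInstanceAs (IsIso (𝟙 _))
        exact (ShortComplex.exact_iff_of_epi_of_isIso_of_mono φ).2
          (ShortComplex.exact_of_f_is_kernel T' J.isLimitKernelFork)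
      | succ n => exact J.exact_succ n)
    (fun n ↦ by
      cases n
      · exact ‹Injective S.X₂›
      · exact J.injective _)

lemma exists_forall_isZero_of_hasInjectiveDimensionLE [EnoughInjectives C] (X : C) (n : ℕ)
    [HasInjectiveDimensionLE X n] :
    ∃ I : InjectiveResolution X, ∀ i, n < i → Limits.IsZero (I.cocomplex.X i) := by
  induction n generalizing X with
  | zero =>
    have : Injective X := injective_iff_hasInjectiveDimensionLT_one.2 ‹_›
    refine ⟨InjectiveResolution.self X, fun i hi ↦ ?_⟩
    exact HomologicalComplex.isZero_single_obj_X _ _ _ _ hi.ne'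
  | succ n ih =>
    obtain ⟨P⟩ := EnoughInjectives.presentation X
    have hS := P.shortExact_shortComplex
    have : Injective P.shortComplex.X₂ := P.injective
    have : HasInjectiveDimensionLE P.shortComplex.X₃ n :=
      (hS.hasInjectiveDimensionLT_X₃_iff n inferInstance).2 ‹_›
    obtain ⟨J, hJ⟩ := ih P.shortComplex.X₃
    refine ⟨ofShortExact hS J, fun i hi ↦ ?_⟩
    obtain _ | i := i
    · omega
    · exact hJ i (by omega)

end CategoryTheory.InjectiveResolution

namespace RingTheory.Sequence

lemma IsRegular.append_singleton {A : Type*} [CommRing A] [IsLocalRing A] {rs : List A} {x : A}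
    (reg : IsRegular A rs) (mem : ∀ y ∈ rs ++ [x], y ∈ maximalIdeal A)
    (hx : IsSMulRegular (A ⧸ Ideal.ofList rs) x) : IsRegular A (rs ++ [x]) := by
  refine ⟨⟨fun i hi ↦ ?_⟩, fun h ↦ ?_⟩
  · rcases (Nat.lt_succ_iff.1 (by simpa using hi)).lt_or_eq with hlt | rfl
    · rw [List.take_append_of_le_length hlt.le, List.getElem_append_left hlt]
      exact reg.regular_mod_prev i hlt
    · have h : Ideal.ofList ((rs ++ [x]).take rs.length) • (⊤ : Submodule A A) =
          Ideal.ofList rs := by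
        rw [List.take_left, smul_eq_mul, Ideal.mul_top]
      rw [(Submodule.quotEquivOfEq _ _ h).isSMulRegular_congr]
      simpa using hx
  · rw [smul_eq_mul, Ideal.mul_top] at h
    refine (maximalIdeal.isMaximal A).ne_top (top_le_iff.1 (h.le.trans ?_))
    exact Ideal.span_le.2 mem

end RingTheory.Sequence

namespace ModuleCat

open Abelian

variable {A : Type u} [CommRing A]

/-- By dévissage, the vanishing of `Ext^n(-, M)` on finite modules can be checked on quotients by
prime ideals. -/
lemma subsingleton_ext_of_forall_quotient_prime [IsNoetherianRing A] (M : ModuleCat.{u} A) (n : ℕ)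
    (h : ∀ p : PrimeSpectrum A, Subsingleton (Ext (ModuleCat.of A (A ⧸ p.asIdeal)) M n))
    (N : Type u) [AddCommGroup N] [Module A N] [Module.Finite A N] :
    Subsingleton (Ext (ModuleCat.of A N) M n) := by
  induction ‹Module.Finite A N› using
    IsNoetherianRing.induction_on_isQuotientEquivQuotientPrime A with
  | subsingleton N =>
    refine subsingleton_of_forall_eq 0 fun x ↦ ?_
    rw [← Ext.mk₀_id_comp x, (isZero_of_subsingleton (ModuleCat.of A N)).eq_of_src (𝟙 _) 0,
      Ext.mk₀_zero, Ext.zero_comp]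
  | quotient N p e =>
    refine subsingleton_of_forall_eq 0 fun x ↦ ?_
    rw [← Ext.mk₀_id_comp x, ← e.toModuleIso.hom_inv_id, ← Ext.mk₀_comp_mk₀_assoc,
      (h p).elim ((Ext.mk₀ e.toModuleIso.inv).comp x (zero_add n)) 0, Ext.comp_zero]
  | exact N₁ N₂ N₃ f g hf hg hfg h₁ h₃ =>
    let S : ShortComplex (ModuleCat.{u} A) :=
      ModuleCat.shortComplexOfCompEqZero f g hfg.linearMap_comp_eq_zero
    have hS : S.ShortExact := ModuleCat.shortComplex_shortExact S hfg hf hg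
    refine subsingleton_of_forall_eq 0 fun x ↦ ?_
    obtain ⟨y, rfl⟩ := Ext.contravariant_sequence_exact₂ hS M x (h₁.elim _ _)
    rw [h₃.elim y 0, Ext.comp_zero]

lemma injective_of_forall_subsingleton_ext_one (M : ModuleCat.{u} A)
    (h : ∀ I : Ideal A, Subsingleton (Ext (ModuleCat.of A (A ⧸ I)) M 1)) : Injective M := by
  rw [← Module.injective_iff_injective_object A M, ← Module.Baer.iff_injective]
  intro I g
  let S : ShortComplex (ModuleCat.{u} A) :=
    ModuleCat.shortComplexOfCompEqZero I.subtype I.mkQ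
      (LinearMap.exact_subtype_mkQ I).linearMap_comp_eq_zero
  have hS : S.ShortExact := ModuleCat.shortComplex_shortExact S
    (LinearMap.exact_subtype_mkQ I) I.injective_subtype I.mkQ_surjective
  obtain ⟨y, hy⟩ := Ext.contravariant_sequence_exact₁ hS M (Ext.mk₀ (ModuleCat.ofHom g))
    rfl ((h I).elim _ _)
  obtain ⟨f, rfl⟩ := (Ext.mk₀_bijective _ _).2 y
  rw [Ext.mk₀_comp_mk₀, (Ext.mk₀_bijective _ _).1.eq_iff] at hy
  refine ⟨f.hom, fun x hx ↦ ?_⟩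
  exact LinearMap.congr_fun (congrArg ModuleCat.Hom.hom hy) ⟨x, hx⟩

lemma hasInjectiveDimensionLE_of_forall_subsingleton_ext (M : ModuleCat.{u} A) (n : ℕ)
    (h : ∀ I : Ideal A, Subsingleton (Ext (ModuleCat.of A (A ⧸ I)) M (n + 1))) :
    HasInjectiveDimensionLE M n := by
  induction n generalizing M with
  | zero =>
    exact injective_iff_hasInjectiveDimensionLT_one.1 (injective_of_forall_subsingleton_ext_one M h)
  | succ n ih =>
    obtain ⟨P⟩ := EnoughInjectives.presentation M
    have hS := P.shortExact_shortComplex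
    have : Injective P.shortComplex.X₂ := P.injective
    refine (hS.hasInjectiveDimensionLT_X₃_iff n inferInstance).1 (ih _ fun I ↦ ?_)
    refine subsingleton_of_forall_eq 0 fun x ↦ ?_
    obtain ⟨y, rfl⟩ := Ext.covariant_sequence_exact₃ _ hS x rfl ((h I).elim _ _)
    rw [Ext.eq_zero_of_injective y, Ext.zero_comp]

section Local

variable [IsNoetherianRing A] [IsLocalRing A]

lemma subsingleton_ext_of_subsingleton_ext_quotSMulTop (N M : ModuleCat.{u} A) [Module.Finite A N]
    [Module.Finite A M] {x : A} (hx : x ∈ maximalIdeal A) (reg : IsSMulRegular N x) (n : ℕ)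
    (h : Subsingleton (Ext (ModuleCat.of A (QuotSMulTop x N)) M (n + 1))) :
    Subsingleton (Ext N M n) := by
  have hS := reg.smulShortComplex_shortExact
  have key : (⊤ : Submodule A (Ext N M n)) ≤ maximalIdeal A • ⊤ := by
    intro y _
    obtain ⟨z, rfl⟩ := Ext.contravariant_sequence_exact₁ hS M y (add_comm 1 n) (h.elim _ _)
    have : (Ext.mk₀ (N.smulShortComplex x).f).comp z (zero_add n) = x • z := by
      change Ext N M n at z
      change (Ext.mk₀ (x • 𝟙 N)).comp z (zero_add n) = x • z
      rw [Ext.mk₀_smul, Ext.smul_comp, Ext.mk₀_id_comp]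
    rw [this]
    exact Submodule.smul_mem_smul hx trivial
  have := Submodule.eq_bot_of_le_smul_of_le_jacobson_bot _ _ Module.Finite.fg_top key
    (IsLocalRing.maximalIdeal_le_jacobson _)
  exact (Submodule.subsingleton_iff A).1 (subsingleton_of_bot_eq_top this.symm)

lemma exists_nontrivial_ext_of_isWeaklyRegular (N M : ModuleCat.{u} A) [Module.Finite A N]
    [Module.Finite A M] (rs : List A) (mem : ∀ x ∈ rs, x ∈ maximalIdeal A)
    (reg : RingTheory.Sequence.IsWeaklyRegular N rs) (n : ℕ) (h : Nontrivial (Ext N M n)) :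
    ∃ L : ModuleCat.{u} A, Nontrivial (Ext L M (n + rs.length)) := by
  induction rs generalizing N n with
  | nil => exact ⟨N, h⟩
  | cons x rs ih =>
    rw [RingTheory.Sequence.isWeaklyRegular_cons_iff] at reg
    rw [List.forall_mem_cons] at mem
    obtain ⟨L, hL⟩ := ih (ModuleCat.of A (QuotSMulTop x N)) mem.2 reg.2 (n + 1) (by
      contrapose! h
      exact subsingleton_ext_of_subsingleton_ext_quotSMulTop N M mem.1 reg.1 n h)
    refine ⟨L, ?_⟩
    rwa [List.length_cons, add_comm rs.length, ← add_assoc]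

lemma length_le_of_hasInjectiveDimensionLE (M : ModuleCat.{u} A) [Module.Finite A M] [Nontrivial M]
    (n : ℕ) [HasInjectiveDimensionLE M n] (rs : List A) (mem : ∀ x ∈ rs, x ∈ maximalIdeal A)
    (reg : RingTheory.Sequence.IsWeaklyRegular A rs) : rs.length ≤ n := by
  have : Nontrivial (Ext (ModuleCat.of A A) M 0) :=
    (Ext.homEquiv₀.trans (ModuleCat.homEquiv.trans
      (LinearMap.ringLmapEquivSelf A A M).toEquiv)).nontrivial
  obtain ⟨L, hL⟩ := exists_nontrivial_ext_of_isWeaklyRegular (ModuleCat.of A A) M rs mem reg 0 this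
  by_contra! hlt
  exact not_subsingleton _
    (HasInjectiveDimensionLT.subsingleton M (n + 1) (0 + rs.length) (by omega) L)

/-- A finite module `M` of injective dimension at most `n` with `Ext^n(k, M) = 0`, where `k` is the
residue field, has injective dimension less than `n`. -/
lemma hasInjectiveDimensionLT_of_subsingleton_ext_residueField (M : ModuleCat.{u} A)
    [Module.Finite A M] (n : ℕ) [HasInjectiveDimensionLE M n]
    (h : Subsingleton (Ext (ModuleCat.of A (A ⧸ maximalIdeal A)) M n)) :
    HasInjectiveDimensionLT M n := by
  have key := subsingleton_ext_of_forall_quotient_prime M n fun p ↦ by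
    by_cases hp : p.asIdeal = maximalIdeal A
    · rwa [hp]
    obtain ⟨x, hx, hxp⟩ := SetLike.exists_of_lt
      ((le_maximalIdeal p.2.ne_top).lt_of_ne hp)
    refine subsingleton_ext_of_subsingleton_ext_quotSMulTop _ M hx ?_ n
      (HasInjectiveDimensionLT.subsingleton M (n + 1) (n + 1) le_rfl _)
    rw [isSMulRegular_iff_right_eq_zero_of_smul]
    intro y hy
    obtain ⟨y, rfl⟩ := Ideal.Quotient.mk_surjective y
    rw [← Ideal.Quotient.mk_eq_mk, ← Submodule.Quotient.mk_smul] at hy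
    rw [Ideal.Quotient.eq_zero_iff_mem]
    exact (p.2.mem_or_mem ((Submodule.Quotient.mk_eq_zero _).1 hy)).resolve_left hxp
  cases n with
  | zero =>
    rw [hasInjectiveDimensionLT_zero_iff_isZero, isZero_iff_subsingleton]
    exact ((Ext.homEquiv₀.trans (ModuleCat.homEquiv.trans
      (LinearMap.ringLmapEquivSelf A A M).toEquiv)).subsingleton_congr).1 (key A)
  | succ n => exact hasInjectiveDimensionLE_of_forall_subsingleton_ext M n fun I ↦ key _

lemma exists_isSMulRegular_of_length_lt (M : ModuleCat.{u} A) [Module.Finite A M] (n : ℕ)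
    [HasInjectiveDimensionLE M n] (hM : ¬ HasInjectiveDimensionLT M n) (rs : List A)
    (reg : RingTheory.Sequence.IsRegular A rs) (hlt : rs.length < n) :
    ∃ x ∈ maximalIdeal A, IsSMulRegular (A ⧸ Ideal.ofList rs) x := by
  by_contra! max
  have h : Nontrivial (Ext (ModuleCat.of A (A ⧸ maximalIdeal A)) M n) := by
    contrapose! hM
    exact hasInjectiveDimensionLT_of_subsingleton_ext_residueField M n hM
  obtain ⟨f, hf⟩ : ∃ f : (A ⧸ maximalIdeal A) →ₗ[A] (A ⧸ Ideal.ofList rs), f ≠ 0 := by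
    rw [← nontrivial_iff_exists_ne]
    contrapose! max
    obtain ⟨x, hx, reg⟩ := IsSMulRegular.subsingleton_linearMap_iff.1 max
    exact ⟨x, by rwa [Ideal.annihilator_quotient] at hx, reg⟩
  have hf : Function.Injective f := by
    have := isSimpleModule_iff_isCoatom.2 (maximalIdeal.isMaximal A).1
    exact f.injective_or_eq_zero.resolve_right hf
  let S : ShortComplex (ModuleCat.{u} A) :=
    ModuleCat.shortComplexOfCompEqZero f f.range.mkQ (by ext; simp)
  have hS : S.ShortExact := ModuleCat.shortComplex_shortExact S
    f.exact_map_mkQ_range hf (Submodule.mkQ_surjective _)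
  have : HasProjectiveDimensionLT (ModuleCat.of A (A ⧸ Ideal.ofList rs)) n := by
    rw [← projectiveDimension_lt_iff, projectiveDimension_eq_of_iso
        (Shrink.linearEquiv A (A ⧸ Ideal.ofList rs)).symm.toModuleIso,
      projectiveDimension_quotient_eq_length rs reg]
    exact_mod_cast hlt
  refine not_subsingleton (Ext (ModuleCat.of A (A ⧸ maximalIdeal A)) M n)
    (subsingleton_of_forall_eq 0 fun y ↦ ?_)
  obtain ⟨z, rfl⟩ := Ext.contravariant_sequence_exact₁ hS M y (add_comm 1 n)
    (Ext.eq_zero_of_hasInjectiveDimensionLT _ (n + 1) le_rfl)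
  rw [z.eq_zero_of_hasProjectiveDimensionLT n le_rfl, Ext.comp_zero]

lemma exists_isRegular_length_eq (M : ModuleCat.{u} A) [Module.Finite A M] (n : ℕ)
    [HasInjectiveDimensionLE M n] (hM : ¬ HasInjectiveDimensionLT M n) :
    ∃ rs : List A, (∀ x ∈ rs, x ∈ maximalIdeal A) ∧
      RingTheory.Sequence.IsRegular A rs ∧ rs.length = n := by
  suffices ∀ k ≤ n, ∃ rs : List A, (∀ x ∈ rs, x ∈ maximalIdeal A) ∧
      RingTheory.Sequence.IsRegular A rs ∧ rs.length = k from this n le_rfl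
  intro k hk
  induction k with
  | zero => exact ⟨[], by simp, RingTheory.Sequence.IsRegular.nil A A, rfl⟩
  | succ k ih =>
    obtain ⟨rs, mem, reg, rfl⟩ := ih (by omega)
    obtain ⟨x, hx, hreg⟩ := exists_isSMulRegular_of_length_lt M n hM rs reg hk
    have mem' : ∀ y ∈ rs ++ [x], y ∈ maximalIdeal A := by
      rw [List.forall_mem_append]
      exact ⟨mem, List.forall_mem_singleton.2 hx⟩
    exact ⟨rs ++ [x], mem', reg.append_singleton mem' hreg, by simp⟩

end Local
end ModuleCat

lemma injDim_le_iff {A : Type} [CommRing A] (M : Type) [AddCommGroup M] [Module A M] (n : ℕ) :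
    injDim A M ≤ n ↔ HasInjectiveDimensionLE (ModuleCat.of A M) n := by
  refine ⟨fun h ↦ ?_, fun h ↦ sInf_le ?_⟩
  · obtain ⟨I, hI⟩ : injDim A M ∈ _ := csInf_mem
      ⟨⊤, (HasInjectiveResolution.out (Z := ModuleCat.of A M)).some, fun i hi ↦ absurd hi (by simp)⟩
    exact I.hasInjectiveDimensionLE_of_isZero fun i hi ↦ hI i (h.trans_lt (by exact_mod_cast hi))
  · obtain ⟨I, hI⟩ :=
      InjectiveResolution.exists_forall_isZero_of_hasInjectiveDimensionLE (ModuleCat.of A M) n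
    exact ⟨I, fun i hi ↦ hI i (by exact_mod_cast hi)⟩

/-- **Bass's equality.** If `M` is a nonzero finitely generated module of finite
injective dimension over a Noetherian local ring `R`, then `id_R M = depth R`. -/
theorem bass_equality
    (M : Type) [AddCommGroup M] [Module R M] [Module.Finite R M] [Nontrivial M]
    (hM : injDim R M < ⊤) :
    injDim R M = depth R R := by
  obtain ⟨n, hn⟩ := ENat.ne_top_iff_exists.1 hM.ne
  have : HasInjectiveDimensionLE (ModuleCat.of R M) n := (injDim_le_iff M n).1 hn.symm.le
  have hlt : ¬ HasInjectiveDimensionLT (ModuleCat.of R M) n := fun h ↦ by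
    cases n with
    | zero =>
      rw [hasInjectiveDimensionLT_zero_iff_isZero, ModuleCat.isZero_iff_subsingleton] at h
      exact not_subsingleton M h
    | succ m =>
      have := hn.trans_le ((injDim_le_iff M m).2 h)
      norm_cast at this
      omega
  rw [← hn]
  refine le_antisymm (le_sSup ?_) (sSup_le ?_)
  · obtain ⟨rs, mem, reg, hrs⟩ := ModuleCat.exists_isRegular_length_eq (ModuleCat.of R M) n hlt
    exact ⟨rs, mem, reg, by rw [hrs]⟩
  · rintro _ ⟨rs, mem, reg, rfl⟩
    exact_mod_cast ModuleCat.length_le_of_hasInjectiveDimensionLE (ModuleCat.of R M) n rs mem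
      reg.toIsWeaklyRegular


end
end

section
/- Let (R, m) be a Noetherian local ring, N a finitely generated R-module, x ∈ m, and M a finitely generated R-module with x regular on M. If for some integer j we have Ext_R^{j+1}(M/xM, N) = 0 and Ext_R^j(M, N) is finitely generated, then Ext_R^j(M, N) = 0. -/
open CategoryTheory IsLocalRing

noncomputable section

variable (R : Type) [CommRing R]

variable [IsNoetherianRing R] [IsLocalRing R]


universe w v u

section

open Limits

/-- The homology of a short complex of modules is the target of any surjection from the cycles
whose kernel consists of the boundaries. -/
def CategoryTheory.ShortComplex.homologyLinearEquivOfSurjective {R : Type*} [Ring R]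
    (S : ShortComplex (ModuleCat R)) {E : Type*} [AddCommGroup E] [Module R E]
    (φ : LinearMap.ker S.g.hom →ₗ[R] E) (hφ : Function.Surjective φ)
    (hker : LinearMap.range S.moduleCatToCycles = LinearMap.ker φ) : S.homology ≃ₗ[R] E :=
  S.moduleCatHomologyIso.toLinearEquiv ≪≫ₗ Submodule.quotEquivOfEq _ _ hker ≪≫ₗ
    φ.quotKerEquivOfSurjective hφ

namespace CategoryTheory.ProjectiveResolution

variable {C : Type*} [Category* C] [Abelian C] [HasExt.{w} C] {X Y : C}
  (P : ProjectiveResolution X)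

lemma extMk_degree_zero_eq_zero_iff (f : P.complex.X 0 ⟶ Y) (m : ℕ) (hm : 0 + 1 = m)
    (hf : P.complex.d m 0 ≫ f = 0) : P.extMk f m hm hf = 0 ↔ f = 0 := by
  refine ⟨fun h ↦ ?_, by rintro rfl; simp⟩
  rw [← P.extEquivCohomologyClass.apply_eq_iff_eq, extEquivCohomologyClass_extMk,
    extEquivCohomologyClass_zero, CochainComplex.HomComplex.CohomologyClass.mk_eq_zero_iff,
    CochainComplex.HomComplex.Cocycle.toSingleMk_mem_coboundaries_iff _ _ _ _ _ 1 (by simp)] at h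
  obtain ⟨g, hg⟩ := h
  have hX : IsZero (P.cochainComplex.X 1) :=
    P.cochainComplex.isZero_of_isStrictlyLE 0 1
  rw [hX.eq_of_src g 0, comp_zero] at hg
  rw [← cancel_epi (P.cochainComplexXIso (-(0 : ℕ)) 0 rfl).hom, ← hg, comp_zero]

variable (R : Type*) [Ring R] [Linear R C]

lemma smul_extMk {n : ℕ} (r : R) (f : P.complex.X n ⟶ Y) (m : ℕ) (hm : n + 1 = m)
    (hf : P.complex.d m n ≫ f = 0) :
    r • P.extMk f m hm hf = P.extMk (r • f) m hm (by simp [hf]) := by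
  simp [Abelian.Ext.smul_eq_comp_mk₀, extMk_comp_mk₀]

/-- The map sending a cocycle of degree `n` to its class in `Ext X Y n`. -/
def cocyclesToExt (Y : C) (n : ℕ) :
    LinearMap.ker ((P.complex.linearYonedaObj R Y).sc n).g.hom →ₗ[R] Abelian.Ext.{w} X Y n where
  toFun f := P.extMk (f.1 : P.complex.X n ⟶ Y) _ (CochainComplex.next ℕ n).symm f.2
  map_add' _ _ := (P.add_extMk _ _ _ _ _ _).symm
  map_smul' r _ := (P.smul_extMk R r _ _ _ _).symm

lemma cocyclesToExt_surjective (n : ℕ) : Function.Surjective (P.cocyclesToExt R Y n) := by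
  intro α
  obtain ⟨f, hf, rfl⟩ := P.extMk_surjective α _ (CochainComplex.next ℕ n).symm
  exact ⟨⟨f, hf⟩, rfl⟩

lemma range_moduleCatToCycles_eq_ker_cocyclesToExt (n : ℕ) :
    LinearMap.range ((P.complex.linearYonedaObj R Y).sc n).moduleCatToCycles =
      LinearMap.ker (P.cocyclesToExt R Y n) := by
  ext ⟨f, hf⟩
  have hrange : ⟨f, hf⟩ ∈
      LinearMap.range ((P.complex.linearYonedaObj R Y).sc n).moduleCatToCycles ↔
      ∃ g : P.complex.X ((ComplexShape.up ℕ).prev n) ⟶ Y,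
        P.complex.d n ((ComplexShape.up ℕ).prev n) ≫ g = f :=
    exists_congr fun _ ↦ Subtype.ext_iff
  rw [hrange, LinearMap.mem_ker]
  cases n with
  | zero =>
    refine Iff.trans ?_ (P.extMk_degree_zero_eq_zero_iff f _ (CochainComplex.next ℕ 0).symm hf).symm
    rw [P.complex.shape _ _ (by simp)]
    simp only [Limits.zero_comp, exists_const]
    exact eq_comm
  | succ p =>
    exact (P.extMk_eq_zero_iff f _ (CochainComplex.next ℕ (p + 1)).symm hf _ (by simp)).symm

/-- The derived functor `Ext` is computed by morphisms in the derived category. -/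
def extLinearEquiv [EnoughProjectives C] (n : ℕ) (Y : C) :
    ((Ext R C n).obj (Opposite.op X)).obj Y ≃ₗ[R] Abelian.Ext.{w} X Y n :=
  (P.isoExt n Y).toLinearEquiv ≪≫ₗ
    ShortComplex.homologyLinearEquivOfSurjective _ (P.cocyclesToExt R Y n)
      (P.cocyclesToExt_surjective R n) (P.range_moduleCatToCycles_eq_ker_cocyclesToExt R n)

end CategoryTheory.ProjectiveResolution

end

/-- If `x` is a nonzerodivisor on `M` lying in the maximal ideal, then a finitely generated
`Ext^j(M, N)` vanishes as soon as `Ext^{j+1}(M/xM, N)` does. -/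
theorem CategoryTheory.Abelian.Ext.subsingleton_of_isSMulRegular {R : Type u} [CommRing R]
    [IsLocalRing R] [Small.{v} R] (M N : ModuleCat.{v} R)
    (x : R) (hx : x ∈ maximalIdeal R) (hreg : IsSMulRegular M x) (j : ℕ)
    [Subsingleton (Abelian.Ext (M.smulShortComplex x).X₃ N (j + 1))]
    [Module.Finite R (Abelian.Ext M N j)] : Subsingleton (Abelian.Ext M N j) := by
  have hsurj (α : Abelian.Ext M N j) : ∃ β : Abelian.Ext M N j, x • β = α := by
    obtain ⟨β, hβ⟩ := Abelian.Ext.contravariant_sequence_exact₁ hreg.smulShortComplex_shortExact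
      N α (add_comm 1 j) (Subsingleton.elim _ _)
    have hsmul (γ : Abelian.Ext M N j) :
        (Abelian.Ext.mk₀ (x • 𝟙 M)).comp γ (zero_add j) = x • γ := by
      rw [Abelian.Ext.mk₀_smul, Abelian.Ext.smul_comp, Abelian.Ext.mk₀_id_comp]
    exact ⟨β, (hsmul β).symm.trans hβ⟩
  by_contra h
  rw [not_subsingleton_iff_nontrivial] at h
  refine Submodule.top_ne_pointwise_smul_of_mem_jacobson_annihilator (M := Abelian.Ext M N j)
    (IsLocalRing.maximalIdeal_le_jacobson _ hx) (eq_top_iff.2 ?_).symm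
  intro α _
  obtain ⟨β, rfl⟩ := hsurj α
  exact Submodule.smul_mem_pointwise_smul _ _ _ trivial

/-- Nakayama vanishing step: if `x` is `M`-regular, `Ext^{j+1}(M/xM, N) = 0` and
`Ext^j(M, N)` is finitely generated, then `Ext^j(M, N) = 0`. -/
theorem ext_vanish_of_quotient
    (M : Type) [AddCommGroup M] [Module R M] [Module.Finite R M]
    (N : Type) [AddCommGroup N] [Module R N] [Module.Finite R N]
    (x : R) (hx : x ∈ maximalIdeal R) (hreg : IsSMulRegular M x) (j : ℕ)
    (hvanish : Subsingleton (ext R (j + 1) (QuotSMulTop x M) N))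
    (hfg : Module.Finite R (ext R j M N)) :
    Subsingleton (ext R j M N) := by
  let e (i : ℕ) (L : Type) [AddCommGroup L] [Module R L] :=
    (projectiveResolution (ModuleCat.of R L)).extLinearEquiv R i (ModuleCat.of R N)
  have : Subsingleton (Abelian.Ext ((ModuleCat.of R M).smulShortComplex x).X₃
      (ModuleCat.of R N) (j + 1)) :=
    (e (j + 1) (QuotSMulTop x M)).symm.toEquiv.subsingleton
  have := Module.Finite.equiv (e j M)
  have := Abelian.Ext.subsingleton_of_isSMulRegular (ModuleCat.of R M) (ModuleCat.of R N) x hx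
    hreg j
  exact (e j M).toEquiv.subsingleton


end
end
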